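/- arXiv:1611.00106 — 3 statements merged into one kernel-verified Lean document; each statement's English description precedes it below -/
import Mathlib

section
/- Let G be a finite connected simple graph that has at least one vertex of degree 1. Then G has a spanning tree T such that the number of vertices that have degree 1 in T but degree at least 2 in G is at most |E(G)| − |V(G)| + 1 (the cycle rank of G). -/
namespace SimpleGraph

variable {V : Type*} {G : SimpleGraph V}

/-- An edge that is not a bridge lies on a cycle, so each of its ends is incident to another
edge that is not a bridge. -/
lemma Adj.exists_ne_adj_not_isBridge {v w : V} (hadj : G.Adj v w) (h : ¬ G.IsBridge s(v, w)) :
    ∃ z, z ≠ w ∧ G.Adj v z ∧ ¬ G.IsBridge s(v, z) := by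
  rw [isBridge_iff_forall_cycle_notMem (G.mem_edgeSet.mpr hadj)] at h
  push Not at h
  obtain ⟨u, p, hp, hmem⟩ := h
  have hcard := hp.ncard_neighborSet_toSubgraph_eq_two (p.fst_mem_support_of_mem_edges hmem)
  obtain ⟨z, hz, hzw⟩ := Set.exists_ne_of_one_lt_ncard (by rw [hcard]; exact one_lt_two) w
  have hz' : p.toSubgraph.Adj v z := hz
  exact ⟨z, hzw, hz'.adj_sub, fun hb ↦
    hb.notMem_edges_of_isCycle hp (Walk.adj_toSubgraph_iff_mem_edges.mp hz')⟩

/-- In a connected graph that has both a bridge and an edge that is not a bridge, some vertex is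
incident to one of each. -/
lemma Connected.exists_isBridge_and_not_isBridge (hconn : G.Connected)
    (hbridge : ∃ v w, G.Adj v w ∧ G.IsBridge s(v, w))
    (hcycle : ∃ x y, G.Adj x y ∧ ¬ G.IsBridge s(x, y)) :
    ∃ b, (∃ c, G.Adj b c ∧ G.IsBridge s(b, c)) ∧ ∃ a, G.Adj b a ∧ ¬ G.IsBridge s(b, a) := by
  obtain ⟨v, w, hvw⟩ := hbridge
  obtain ⟨x, y, hxy⟩ := hcycle
  by_cases hx : ∃ c, G.Adj x c ∧ G.IsBridge s(x, c)
  · exact ⟨x, hx, y, hxy⟩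
  obtain ⟨p⟩ := hconn.preconnected v x
  obtain ⟨d, -, hd₁, hd₂⟩ :=
    p.exists_boundary_dart {b | ∃ c, G.Adj b c ∧ G.IsBridge s(b, c)} ⟨w, hvw⟩ hx
  refine ⟨d.fst, hd₁, d.snd, d.adj, fun hb ↦ hd₂ ⟨d.fst, d.adj.symm, ?_⟩⟩
  rwa [Sym2.eq_swap]

/-- A finite connected graph with a bridge has a spanning tree with at most as many new leaves as
there are deleted edges. -/
theorem Connected.exists_isTree_ncard_new_leaves_add_card_le [Finite V] (hconn : G.Connected)
    (hbridge : ∃ v w, G.Adj v w ∧ G.IsBridge s(v, w)) :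
    ∃ T ≤ G, T.IsTree ∧
      {v | (T.neighborSet v).ncard = 1 ∧ 2 ≤ (G.neighborSet v).ncard}.ncard + Nat.card V ≤
        G.edgeSet.ncard + 1 := by
  induction hn : G.edgeSet.ncard generalizing G with
  | zero =>
    obtain ⟨v, w, hvw, -⟩ := hbridge
    rw [Set.ncard_eq_zero] at hn
    exact absurd (G.mem_edgeSet.mpr hvw) (by simp [hn])
  | succ n ih =>
    by_cases hacyc : G.IsAcyclic
    · have htree : G.IsTree := ⟨hconn, hacyc⟩
      refine ⟨G, le_rfl, htree, ?_⟩
      have hempty : {v | (G.neighborSet v).ncard = 1 ∧ 2 ≤ (G.neighborSet v).ncard} = ∅ := by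
        ext v
        simp only [Set.mem_ofPred_eq, Set.mem_empty_iff_false, iff_false]
        omega
      have hcard := (isTree_iff_connected_and_card.mp htree).2
      rw [Nat.card_coe_set_eq, hn] at hcard
      rw [hempty, Set.ncard_empty]
      omega
    rw [isAcyclic_iff_forall_adj_isBridge] at hacyc
    push Not at hacyc
    obtain ⟨b, ⟨c, hbc, hbc_bridge⟩, a, hba, hba_bridge⟩ :=
      hconn.exists_isBridge_and_not_isBridge hbridge hacyc
    obtain ⟨z, hza, hbz, hbz_bridge⟩ := hba.exists_ne_adj_not_isBridge hba_bridge
    have hca : c ≠ a := by rintro rfl; exact hba_bridge hbc_bridge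
    have hcz : c ≠ z := by rintro rfl; exact hbz_bridge hbc_bridge
    set H := G.deleteEdges {s(b, a)} with hH
    have hHG : H ≤ G := deleteEdges_le _
    have hbc' : H.Adj b c := by simp [hH, hbc, hca, hba.ne]
    have hbz' : H.Adj b z := by simp [hH, hbz, hza, hba.ne]
    have hedge : H.edgeSet.ncard = n := by
      rw [hH, edgeSet_deleteEdges, Set.ncard_sdiff_singleton_of_mem (G.mem_edgeSet.mpr hba), hn]
      rfl
    obtain ⟨T, hTH, hT, hcard⟩ := ih (G := H)
      (hconn.connected_delete_edge_of_not_isBridge hba_bridge)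
      ⟨b, c, hbc', hbc_bridge.anti hHG⟩ hedge
    refine ⟨T, hTH.trans hHG, hT, ?_⟩
    have hsub : {v | (T.neighborSet v).ncard = 1 ∧ 2 ≤ (G.neighborSet v).ncard} ⊆
        insert a {v | (T.neighborSet v).ncard = 1 ∧ 2 ≤ (H.neighborSet v).ncard} := by
      rintro v ⟨hv₁, hv₂⟩
      by_cases hva : v = a
      · exact .inl hva
      refine .inr ⟨hv₁, ?_⟩
      by_cases hvb : v = b
      · subst hvb
        exact (Set.one_lt_ncard_iff (Set.toFinite _)).mpr ⟨c, z, hbc', hbz', hcz⟩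
      · have heq : H.neighborSet v = G.neighborSet v := by
          ext u
          simp [hH, hva, hvb]
        rwa [heq]
    have hle := (Set.ncard_le_ncard hsub (Set.toFinite _)).trans (Set.ncard_insert_le _ _)
    omega

/-- The edge at a leaf is a bridge. -/
lemma exists_adj_isBridge_of_ncard_neighborSet_eq_one {v : V}
    (hv : (G.neighborSet v).ncard = 1) : ∃ w, G.Adj v w ∧ G.IsBridge s(v, w) := by
  obtain ⟨w, hw⟩ := Set.ncard_eq_one.mp hv
  have hnbr (z : V) : G.Adj v z ↔ z = w := by rw [← mem_neighborSet, hw, Set.mem_singleton_iff]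
  have hvw : G.Adj v w := (hnbr w).mpr rfl
  refine ⟨w, hvw, ?_⟩
  by_contra hb
  obtain ⟨z, hzw, hvz, -⟩ := hvw.exists_ne_adj_not_isBridge hb
  exact hzw ((hnbr z).mp hvz)

end SimpleGraph

/-!
STATEMENT 4: Let `G` be a finite connected simple graph that has at least one vertex of
degree 1.  Then `G` has a spanning tree `T` such that the number of vertices having
degree 1 in `T` but degree at least 2 in `G` is at most `|E(G)| − |V(G)| + 1`
(the cycle rank of `G`).
-/
theorem exists_spanning_tree_few_new_leaves
    {V : Type*} [Fintype V] (G : SimpleGraph V)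
    (hconn : G.Connected)
    (hleaf : ∃ v : V, (G.neighborSet v).ncard = 1) :
    ∃ T : SimpleGraph V, T ≤ G ∧ T.IsTree ∧
      ({v : V | (T.neighborSet v).ncard = 1 ∧ 2 ≤ (G.neighborSet v).ncard}.ncard : ℤ) ≤
        (G.edgeSet.ncard : ℤ) - (Fintype.card V : ℤ) + 1 := by
  obtain ⟨v, hv⟩ := hleaf
  obtain ⟨T, hTG, hT, hcard⟩ := hconn.exists_isTree_ncard_new_leaves_add_card_le
    ⟨v, SimpleGraph.exists_adj_isBridge_of_ncard_neighborSet_eq_one hv⟩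
  rw [Nat.card_eq_fintype_card] at hcard
  exact ⟨T, hTG, hT, by omega⟩
end

section
/- Let G be a finite connected simple graph that has at least one vertex of degree 1, and let M be a perfect matching of G. Then G has a spanning tree T whose edge set contains M, such that every vertex v that has degree 1 in T but degree at least 2 in G has its unique incident edge of T belonging to M, and the number of such vertices v is at most |E(G)| − |V(G)| + 1 (the cycle rank of G). -/
namespace SimpleGraph

variable {V : Type*}

lemma Preconnected.mem_of_forall_adj_mem {G : SimpleGraph V} (hG : G.Preconnected) {S : Set V}
    (hS : ∀ a ∈ S, ∀ b, G.Adj a b → b ∈ S) {a : V} (ha : a ∈ S) (b : V) : b ∈ S := by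
  obtain ⟨p⟩ := hG a b
  induction p with
  | nil => exact ha
  | cons h _ ih => exact ih (hS _ ha _ h)

lemma eq_of_adj_of_ncard_neighborSet_eq_one {G : SimpleGraph V} {v a b : V}
    (hv : (G.neighborSet v).ncard = 1) (ha : G.Adj v a) (hb : G.Adj v b) : a = b := by
  obtain ⟨c, hc⟩ := Set.ncard_eq_one.mp hv
  have ha' : a ∈ G.neighborSet v := ha
  have hb' : b ∈ G.neighborSet v := hb
  rw [hc] at ha' hb'
  exact ha'.trans hb'.symm

/-- Exchanging an edge of the tree path from `u` to `v` for the edge `uv` yields a tree. -/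
lemma IsTree.isTree_deleteEdges_sup_edge [Finite V] {T : SimpleGraph V} (hT : T.IsTree)
    {u v w x : V} (huv : u ≠ v) (hadj : ¬ T.Adj u v) {p : T.Walk u v} (hp : p.IsPath)
    (hwx : s(w, x) ∈ p.edges) : ((T ⊔ edge u v).deleteEdges {s(w, x)}).IsTree := by
  have hle : T ≤ T ⊔ edge u v := le_sup_left
  have hvu : (T ⊔ edge u v).Adj v u := by simp [edge_adj, huv, huv.symm]
  have hwxT : s(w, x) ∈ T.edgeSet := p.edges_subset_edgeSet hwx
  rw [isTree_iff_connected_and_card] at hT ⊢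
  constructor
  · refine (hT.1.mono hle).connected_delete_edge_of_not_isBridge fun hbr ↦ ?_
    refine (isBridge_iff_forall_cycle_notMem (edgeSet_mono hle hwxT)).mp hbr
      (Walk.cons hvu (p.mapLe hle)) ?_ ?_
    · rw [Walk.cons_isCycle_iff]
      refine ⟨hp.mapLe hle, fun h ↦ hadj ?_⟩
      rw [Walk.edges_mapLe_eq_edges] at h
      exact (p.edges_subset_edgeSet h : T.Adj v u).symm
    · simp [hwx]
  · rw [← hT.2]
    congr 1
    have hE : ((T ⊔ edge u v).deleteEdges {s(w, x)}).edgeSet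
        = insert s(u, v) T.edgeSet \ {s(w, x)} := by
      rw [edgeSet_deleteEdges, edgeSet_sup, edgeSet_edge_of_ne huv, Set.union_singleton]
    rw [hE, Nat.card_coe_set_eq, Nat.card_coe_set_eq,
      Set.ncard_sdiff_singleton_of_mem (Set.mem_insert_of_mem _ hwxT),
      Set.ncard_insert_of_notMem (by simpa using hadj)]
    simp

lemma Walk.IsPath.exists_two_neighbors_of_mem_support {T : SimpleGraph V} {u v w : V}
    {p : T.Walk u v} (hp : p.IsPath) (hw : w ∈ p.support) (hu : w ≠ u) (hv : w ≠ v) :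
    ∃ a b, a ≠ b ∧ s(w, a) ∈ p.edges ∧ s(w, b) ∈ p.edges := by
  obtain ⟨i, rfl, hi⟩ := Walk.mem_support_iff_exists_getVert.mp hw
  have hi0 : i ≠ 0 := by rintro rfl; simp at hu
  have hil : i ≠ p.length := by rintro rfl; simp at hv
  obtain ⟨j, rfl⟩ := Nat.exists_eq_succ_of_ne_zero hi0
  refine ⟨p.getVert j, p.getVert (j + 1 + 1), fun h ↦ ?_, ?_, ?_⟩
  · have := hp.getVert_injOn (show j ∈ {i | i ≤ p.length} by simp; omega)
      (show j + 1 + 1 ∈ {i | i ≤ p.length} by simp; omega) h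
    omega
  · rw [Sym2.eq_swap]
    exact (p.mem_edges_toSubgraph).mp (p.toSubgraph_adj_getVert (by omega))
  · exact (p.mem_edges_toSubgraph).mp (p.toSubgraph_adj_getVert (by omega))

/-- A path joining two leaves of a connected graph with a third leaf meets a branch vertex. -/
lemma Walk.IsPath.exists_branch_vertex {T : SimpleGraph V} (hT : T.Connected) {u v r : V}
    {p : T.Walk u v} (hp : p.IsPath) (huv : u ≠ v) (hu : (T.neighborSet u).ncard = 1)
    (hv : (T.neighborSet v).ncard = 1) (hr : (T.neighborSet r).ncard = 1) (hru : r ≠ u)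
    (hrv : r ≠ v) :
    ∃ w a b y, a ≠ b ∧ y ≠ a ∧ y ≠ b ∧ T.Adj w y ∧ s(w, a) ∈ p.edges ∧ s(w, b) ∈ p.edges := by
  have hr' : r ∉ p.support := fun h ↦ by
    obtain ⟨a, b, hab, ha, hb⟩ := hp.exists_two_neighbors_of_mem_support h hru hrv
    exact hab (eq_of_adj_of_ncard_neighborSet_eq_one hr (p.adj_of_mem_edges ha)
      (p.adj_of_mem_edges hb))
  obtain ⟨w, hw, y, hwy, hy⟩ : ∃ w ∈ p.support, ∃ y, T.Adj w y ∧ y ∉ p.support := by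
    by_contra! h
    exact hr' (hT.preconnected.mem_of_forall_adj_mem (S := {x | x ∈ p.support}) h
      p.start_mem_support r)
  have hnil : ¬ p.Nil := Walk.not_nil_of_ne huv
  have hwu : w ≠ u := by
    rintro rfl
    exact hy (eq_of_adj_of_ncard_neighborSet_eq_one hu (p.adj_snd hnil) hwy ▸
      p.getVert_mem_support _)
  have hwv : w ≠ v := by
    rintro rfl
    exact hy (eq_of_adj_of_ncard_neighborSet_eq_one hv (p.adj_penultimate hnil).symm hwy ▸
      p.getVert_mem_support _)
  obtain ⟨a, b, hab, ha, hb⟩ := hp.exists_two_neighbors_of_mem_support hw hwu hwv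
  refine ⟨w, a, b, y, hab, ?_, ?_, hwy, ha, hb⟩
  · rintro rfl
    exact hy (p.snd_mem_support_of_mem_edges ha)
  · rintro rfl
    exact hy (p.snd_mem_support_of_mem_edges hb)

lemma isAcyclic_fromEdgeSet_of_existsUnique {M : Set (Sym2 V)}
    (hM : ∀ v : V, ∃! e : Sym2 V, e ∈ M ∧ v ∈ e) : (fromEdgeSet M).IsAcyclic := by
  intro v c hc
  have h1 := (fromEdgeSet_adj M).mp (c.adj_snd hc.not_nil)
  have h2 := (fromEdgeSet_adj M).mp (c.adj_penultimate hc.not_nil)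
  have h := (hM v).unique ⟨h1.1, Sym2.mem_mk_left _ _⟩ ⟨h2.1, Sym2.mem_mk_right _ _⟩
  rw [Sym2.eq_swap, Sym2.congr_left] at h
  exact hc.snd_ne_penultimate h

/-- If two leaves of a spanning tree are adjacent in the ambient graph and the tree has a third
leaf, then the tree can be exchanged for one with fewer leaves containing the same perfect
matching. -/
lemma IsTree.exists_isTree_ncard_leaves_lt [Finite V] {G T : SimpleGraph V} {M : Set (Sym2 V)}
    (hM : ∀ v : V, ∃! e : Sym2 V, e ∈ M ∧ v ∈ e) (hTG : T ≤ G) (hT : T.IsTree)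
    (hMT : M ⊆ T.edgeSet) {u v r : V} (huv : G.Adj u v) (hu : (T.neighborSet u).ncard = 1)
    (hv : (T.neighborSet v).ncard = 1) (hr : (T.neighborSet r).ncard = 1) (hru : r ≠ u)
    (hrv : r ≠ v) :
    ∃ T' : SimpleGraph V, T' ≤ G ∧ T'.IsTree ∧ M ⊆ T'.edgeSet ∧
      {z | (T'.neighborSet z).ncard = 1}.ncard < {z | (T.neighborSet z).ncard = 1}.ncard := by
  have hne : u ≠ v := huv.ne
  have hadj : ¬ T.Adj u v := fun h ↦ by
    obtain ⟨w, a, b, y, hab, -, -, -, ha, hb⟩ :=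
      (Walk.IsPath.of_adj h).exists_branch_vertex hT.connected hne hu hv hr hru hrv
    simp only [Walk.edges_cons, Walk.edges_nil, List.mem_singleton, Adj.toWalk] at ha hb
    exact hab (Sym2.congr_right.mp (ha.trans hb.symm))
  obtain ⟨p, hp⟩ := hT.connected.exists_isPath u v
  obtain ⟨w, x, b, y, hxb, hyx, hyb, hwy, hx, hb, hxM⟩ : ∃ w x b y, x ≠ b ∧ y ≠ x ∧ y ≠ b ∧
      T.Adj w y ∧ s(w, x) ∈ p.edges ∧ s(w, b) ∈ p.edges ∧ s(w, x) ∉ M := by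
    obtain ⟨w, a, b, y, hab, hya, hyb, hwy, ha, hb⟩ :=
      hp.exists_branch_vertex hT.connected hne hu hv hr hru hrv
    by_cases haM : s(w, a) ∈ M
    · refine ⟨w, b, a, y, hab.symm, hyb, hya, hwy, hb, ha, fun hbM ↦ hab ?_⟩
      exact Sym2.congr_right.mp ((hM w).unique ⟨haM, Sym2.mem_mk_left _ _⟩
        ⟨hbM, Sym2.mem_mk_left _ _⟩)
    · exact ⟨w, a, b, y, hab, hya, hyb, hwy, ha, hb, haM⟩
  have hwx : T.Adj w x := p.adj_of_mem_edges hx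
  have hwb : T.Adj w b := p.adj_of_mem_edges hb
  set T' := (T ⊔ edge u v).deleteEdges {s(w, x)} with hT'
  have hMT' : M ⊆ T'.edgeSet := fun e he ↦ by
    rw [hT', edgeSet_deleteEdges, edgeSet_sup]
    exact ⟨Or.inl (hMT he), fun h ↦ hxM (h ▸ he)⟩
  have hadj' : ∀ {a c}, T.Adj a c → s(a, c) ≠ s(w, x) → T'.Adj a c := fun h h' ↦ by
    rw [hT', deleteEdges_adj]
    exact ⟨Or.inl h, h'⟩
  have hend : ∀ z z', T'.Adj z z' → ¬ T.Adj z z' → (T'.neighborSet z).ncard ≠ 1 := by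
    intro z z' h h' h1
    obtain ⟨e, ⟨heM, hze⟩, -⟩ := hM z
    obtain ⟨c, rfl⟩ := Sym2.mem_iff_exists.mp hze
    have := eq_of_adj_of_ncard_neighborSet_eq_one h1 h (hMT' heM)
    exact h' (this ▸ hMT heM)
  have huv' : T'.Adj u v := by
    rw [hT', deleteEdges_adj]
    refine ⟨Or.inr (by simp [edge_adj, hne]), fun h ↦ hadj ?_⟩
    rw [← mem_edgeSet, h]
    exact hwx
  have hu' : (T'.neighborSet u).ncard ≠ 1 := hend u v huv' hadj
  have hv' : (T'.neighborSet v).ncard ≠ 1 := hend v u huv'.symm fun h ↦ hadj h.symm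
  have hw' : (T'.neighborSet w).ncard ≠ 1 := fun h ↦ hyb <|
    eq_of_adj_of_ncard_neighborSet_eq_one h
      (hadj' hwy fun h ↦ hyx (Sym2.congr_right.mp h))
      (hadj' hwb fun h ↦ hxb (Sym2.congr_right.mp h).symm)
  have hrest : ∀ z, z ≠ x → (T'.neighborSet z).ncard = 1 → (T.neighborSet z).ncard = 1 := by
    intro z hzx hz
    have hzu : z ≠ u := by rintro rfl; exact hu' hz
    have hzv : z ≠ v := by rintro rfl; exact hv' hz
    have hzw : z ≠ w := by rintro rfl; exact hw' hz
    rw [← hz]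
    congr 1
    ext c
    simp [hT', edge_adj, hzx, hzu, hzv, hzw]
  refine ⟨T', ?_, hT.isTree_deleteEdges_sup_edge hne hadj hp hx, hMT', ?_⟩
  · refine (deleteEdges_le _).trans (sup_le hTG ?_)
    rw [edge_le_iff]
    exact Or.inr huv
  · set L := {z | (T.neighborSet z).ncard = 1}
    have hsub : {z | (T'.neighborSet z).ncard = 1} ⊆ insert x ((L \ {u}) \ {v}) := by
      intro z hz
      by_cases hzx : z = x
      · exact Or.inl hzx
      · refine Or.inr ⟨⟨hrest z hzx hz, ?_⟩, ?_⟩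
        · rintro rfl; exact hu' hz
        · rintro rfl; exact hv' hz
    have h1 := Set.ncard_le_ncard hsub
    have h2 := Set.ncard_insert_le x ((L \ {u}) \ {v})
    have h3 := Set.ncard_sdiff_singleton_lt_of_mem (s := L \ {u}) (a := v) ⟨hv, hne.symm⟩
    have h4 := Set.ncard_sdiff_singleton_lt_of_mem (s := L) (a := u) hu
    omega

end SimpleGraph

/-!
STATEMENT 5: Let `G` be a finite connected simple graph with at least one vertex of
degree 1, and let `M` be a perfect matching of `G` (a set of edges of `G` such that
every vertex is incident to exactly one edge of `M`).  Then `G` has a spanning tree `T`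
whose edge set contains `M`, such that every vertex `v` having degree 1 in `T` but
degree at least 2 in `G` has its unique incident edge of `T` belonging to `M`, and the
number of such vertices `v` is at most `|E(G)| − |V(G)| + 1` (the cycle rank of `G`).
-/
theorem exists_spanning_tree_containing_perfect_matching_few_new_leaves
    {V : Type*} [Fintype V] (G : SimpleGraph V)
    (hconn : G.Connected)
    (hleaf : ∃ v : V, (G.neighborSet v).ncard = 1)
    (M : Set (Sym2 V))
    (hMsub : M ⊆ G.edgeSet)
    (hMmatch : ∀ v : V, ∃! e : Sym2 V, e ∈ M ∧ v ∈ e) :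
    ∃ T : SimpleGraph V, T ≤ G ∧ T.IsTree ∧ M ⊆ T.edgeSet ∧
      (∀ v : V, (T.neighborSet v).ncard = 1 → 2 ≤ (G.neighborSet v).ncard →
        ∀ e ∈ T.edgeSet, v ∈ e → e ∈ M) ∧
      ({v : V | (T.neighborSet v).ncard = 1 ∧ 2 ≤ (G.neighborSet v).ncard}.ncard : ℤ) ≤
        (G.edgeSet.ncard : ℤ) - (Fintype.card V : ℤ) + 1 := by
  classical
  obtain ⟨r, hr⟩ := hleaf
  set P : Set (SimpleGraph V) := {T | T ≤ G ∧ T.IsTree ∧ M ⊆ T.edgeSet}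
  have hPne : P.Nonempty := by
    obtain ⟨T, hMT, hTG, hT⟩ := hconn.exists_isTree_le_of_le_of_isAcyclic
      (H := SimpleGraph.fromEdgeSet M)
      (fun a b h ↦ hMsub ((SimpleGraph.fromEdgeSet_adj M).mp h).1)
      (SimpleGraph.isAcyclic_fromEdgeSet_of_existsUnique hMmatch)
    refine ⟨T, hTG, hT, fun e he ↦ SimpleGraph.edgeSet_mono hMT ?_⟩
    rw [SimpleGraph.edgeSet_fromEdgeSet]
    exact ⟨he, G.not_isDiag_of_mem_edgeSet (hMsub he)⟩
  obtain ⟨T, ⟨hTG, hT, hMT⟩, hmin⟩ := P.toFinite.exists_minimalFor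
    (fun T ↦ {z | (T.neighborSet z).ncard = 1}.ncard) P hPne
  have hrT : (T.neighborSet r).ncard = 1 := by
    obtain ⟨e, ⟨heM, hre⟩, -⟩ := hMmatch r
    obtain ⟨c, rfl⟩ := Sym2.mem_iff_exists.mp hre
    have h1 : (T.neighborSet r).ncard ≤ 1 := hr ▸ Set.ncard_le_ncard fun z hz ↦ hTG hz
    have h2 : 0 < (T.neighborSet r).ncard := (Set.ncard_pos).mpr ⟨c, hMT heM⟩
    omega
  set L := {v : V | (T.neighborSet v).ncard = 1 ∧ 2 ≤ (G.neighborSet v).ncard}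
  have hindep : ∀ u ∈ L, ∀ v ∈ L, ¬ G.Adj u v := by
    rintro u ⟨hu, hu2⟩ v ⟨hv, hv2⟩ huv
    obtain ⟨T', h1, h2, h3, h4⟩ := hT.exists_isTree_ncard_leaves_lt hMmatch hTG hMT huv hu hv hrT
      (by rintro rfl; omega) (by rintro rfl; omega)
    exact absurd (hmin (j := T') ⟨h1, h2, h3⟩ h4.le) (not_le.mpr h4)
  refine ⟨T, hTG, hT, hMT, ?_, ?_⟩
  · intro v hv _ e he hve
    obtain ⟨f, ⟨hfM, hvf⟩, -⟩ := hMmatch v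
    obtain ⟨a, rfl⟩ := Sym2.mem_iff_exists.mp hve
    obtain ⟨b, rfl⟩ := Sym2.mem_iff_exists.mp hvf
    have hab : a = b := SimpleGraph.eq_of_adj_of_ncard_neighborSet_eq_one hv he (hMT hfM)
    exact hab ▸ hfM
  · have hnew : ∀ v ∈ L, ∃ a, G.Adj v a ∧ ¬ T.Adj v a := by
      rintro v ⟨hv, hv2⟩
      by_contra! h
      have : (G.neighborSet v).ncard ≤ (T.neighborSet v).ncard :=
        Set.ncard_le_ncard fun z hz ↦ h z hz
      omega
    choose! f hfG hfT using hnew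
    have hcard : L.ncard ≤ (G.edgeSet \ T.edgeSet).ncard := by
      refine Set.ncard_le_ncard_of_injOn (fun v ↦ s(v, f v))
        (fun v hv ↦ ⟨hfG v hv, hfT v hv⟩) fun u hu v hv huv ↦ ?_
      by_contra hne
      rcases Sym2.eq_iff.mp huv with ⟨h, -⟩ | ⟨-, h⟩
      · exact hne h
      · exact hindep u hu v hv (h ▸ hfG u hu)
    have hsplit := Set.ncard_sdiff_add_ncard_of_subset (SimpleGraph.edgeSet_mono hTG)
    have htree := (SimpleGraph.isTree_iff_connected_and_card.mp hT).2
    rw [Nat.card_coe_set_eq, Nat.card_eq_fintype_card] at htree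
    change (L.ncard : ℤ) ≤ _
    omega
end

section
/- For every integer ℓ ≥ 1, consider the simple graph P_ℓ on the 2ℓ vertices {(i, L), (i, R) : 1 ≤ i ≤ ℓ} whose edges are exactly: the spiral edges {(i,L), (i,R)} for every 1 ≤ i ≤ ℓ; the R-connector edges {(i,R), (j,R)} for every pair 1 ≤ i < j ≤ ℓ with i + j = ℓ + 1; and the L-connector edges {(i,L), (j,L)} for every pair 2 ≤ i < j ≤ ℓ with i + j = ℓ + 2. Then P_ℓ is a path on all 2ℓ vertices: it is connected, exactly two of its vertices have degree 1 and all other vertices have degree 2, and its two degree-1 vertices are (1, L) and the vertex (ℓ/2 + 1, L) if ℓ is even, or ((ℓ+1)/2, R) if ℓ is odd. -/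
/-!
STATEMENT 6: For every integer `ℓ ≥ 1`, the graph `P_ℓ` on the `2ℓ` vertices
`(i, L), (i, R)` for `1 ≤ i ≤ ℓ`, with exactly the spiral edges `{(i,L),(i,R)}`
(`1 ≤ i ≤ ℓ`), the R-connector edges `{(i,R),(j,R)}` (`1 ≤ i < j ≤ ℓ`, `i + j = ℓ + 1`),
and the L-connector edges `{(i,L),(j,L)}` (`2 ≤ i < j ≤ ℓ`, `i + j = ℓ + 2`),
is a path on all `2ℓ` vertices: it is connected, exactly two of its vertices have
degree 1 and all others have degree 2, and its two degree-1 vertices are `(1, L)`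
together with `(ℓ/2 + 1, L)` if `ℓ` is even, or `((ℓ+1)/2, R)` if `ℓ` is odd.
-/

/-- The two sides of a spiral path: `L` for the left endpoint, `R` for the right one. -/
inductive Side : Type
  | L : Side
  | R : Side
  deriving DecidableEq

/-- The stitching graph `P_ℓ`, on vertex set `{1, …, ℓ} × {L, R}`.  Its edges are
exactly the spiral edges, the R-connector edges and the L-connector edges. -/
def stitchGraph (ℓ : ℕ) : SimpleGraph ((Set.Icc 1 ℓ : Set ℕ) × Side) :=
  SimpleGraph.fromRel (fun x y =>
    -- spiral edges {(i,L),(i,R)} for 1 ≤ i ≤ ℓ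
    ((x.1 : ℕ) = (y.1 : ℕ) ∧ x.2 = Side.L ∧ y.2 = Side.R) ∨
    -- R-connector edges {(i,R),(j,R)} for 1 ≤ i < j ≤ ℓ with i + j = ℓ + 1
    (x.2 = Side.R ∧ y.2 = Side.R ∧ (x.1 : ℕ) < (y.1 : ℕ) ∧
      (x.1 : ℕ) + (y.1 : ℕ) = ℓ + 1) ∨
    -- L-connector edges {(i,L),(j,L)} for 2 ≤ i < j ≤ ℓ with i + j = ℓ + 2
    (x.2 = Side.L ∧ y.2 = Side.L ∧ 2 ≤ (x.1 : ℕ) ∧ (x.1 : ℕ) < (y.1 : ℕ) ∧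
      (x.1 : ℕ) + (y.1 : ℕ) = ℓ + 2))

namespace stitchGraph

variable {ℓ i j : ℕ}

theorem adj_L_R (hi : i ∈ Set.Icc 1 ℓ) (hj : j ∈ Set.Icc 1 ℓ) :
    (stitchGraph ℓ).Adj (⟨i, hi⟩, Side.L) (⟨j, hj⟩, Side.R) ↔ i = j := by
  simp [stitchGraph]

theorem adj_R_L (hi : i ∈ Set.Icc 1 ℓ) (hj : j ∈ Set.Icc 1 ℓ) :
    (stitchGraph ℓ).Adj (⟨i, hi⟩, Side.R) (⟨j, hj⟩, Side.L) ↔ i = j := by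
  rw [SimpleGraph.adj_comm, adj_L_R, eq_comm]

theorem adj_L_L (hi : i ∈ Set.Icc 1 ℓ) (hj : j ∈ Set.Icc 1 ℓ) :
    (stitchGraph ℓ).Adj (⟨i, hi⟩, Side.L) (⟨j, hj⟩, Side.L) ↔ i ≠ j ∧ i + j = ℓ + 2 := by
  have := hi.2
  have := hj.2
  simp [stitchGraph]
  omega

theorem adj_R_R (hi : i ∈ Set.Icc 1 ℓ) (hj : j ∈ Set.Icc 1 ℓ) :
    (stitchGraph ℓ).Adj (⟨i, hi⟩, Side.R) (⟨j, hj⟩, Side.R) ↔ i ≠ j ∧ i + j = ℓ + 1 := by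
  simp [stitchGraph]
  omega

theorem ncard_neighborSet_L (hi : i ∈ Set.Icc 1 ℓ) :
    ((stitchGraph ℓ).neighborSet (⟨i, hi⟩, Side.L)).ncard =
      if i = 1 ∨ 2 * i = ℓ + 2 then 1 else 2 := by
  obtain ⟨h1, hl⟩ := id hi
  split_ifs with h
  · rw [Set.ncard_eq_one]
    refine ⟨(⟨i, hi⟩, Side.R), ?_⟩
    ext ⟨⟨j, hj⟩, _ | _⟩
    · have := hj.2
      simp [adj_L_L]
      omega
    · simp [adj_L_R, eq_comm]
  · rw [Set.ncard_eq_two]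
    refine ⟨(⟨i, hi⟩, Side.R), (⟨ℓ + 2 - i, by grind⟩, Side.L), by simp, ?_⟩
    ext ⟨⟨j, hj⟩, _ | _⟩
    · simp [adj_L_L]
      omega
    · simp [adj_L_R, eq_comm]

theorem ncard_neighborSet_R (hi : i ∈ Set.Icc 1 ℓ) :
    ((stitchGraph ℓ).neighborSet (⟨i, hi⟩, Side.R)).ncard =
      if 2 * i = ℓ + 1 then 1 else 2 := by
  obtain ⟨h1, hl⟩ := id hi
  split_ifs with h
  · rw [Set.ncard_eq_one]
    refine ⟨(⟨i, hi⟩, Side.L), ?_⟩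
    ext ⟨⟨j, hj⟩, _ | _⟩
    · simp [adj_R_L, eq_comm]
    · simp [adj_R_R]
      omega
  · rw [Set.ncard_eq_two]
    refine ⟨(⟨i, hi⟩, Side.L), (⟨ℓ + 1 - i, by grind⟩, Side.R), by simp, ?_⟩
    ext ⟨⟨j, hj⟩, _ | _⟩
    · simp [adj_R_L, eq_comm]
    · simp [adj_R_R]
      omega

theorem reachable_L_R (hi : i ∈ Set.Icc 1 ℓ) :
    (stitchGraph ℓ).Reachable (⟨i, hi⟩, Side.L) (⟨i, hi⟩, Side.R) :=
  ((adj_L_R hi hi).2 rfl).reachable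

theorem reachable_L_L (hi : i ∈ Set.Icc 1 ℓ) (hj : j ∈ Set.Icc 1 ℓ) (h : i + j = ℓ + 2) :
    (stitchGraph ℓ).Reachable (⟨i, hi⟩, Side.L) (⟨j, hj⟩, Side.L) := by
  by_cases hij : i = j
  · subst hij
    rfl
  · exact ((adj_L_L hi hj).2 ⟨hij, h⟩).reachable

theorem reachable_R_R (hi : i ∈ Set.Icc 1 ℓ) (hj : j ∈ Set.Icc 1 ℓ) (h : i + j = ℓ + 1) :
    (stitchGraph ℓ).Reachable (⟨i, hi⟩, Side.R) (⟨j, hj⟩, Side.R) := by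
  by_cases hij : i = j
  · subst hij
    rfl
  · exact ((adj_R_R hi hj).2 ⟨hij, h⟩).reachable

theorem reachable_L_L_succ (hi : i ∈ Set.Icc 1 ℓ) (hi' : i + 1 ∈ Set.Icc 1 ℓ) :
    (stitchGraph ℓ).Reachable (⟨i, hi⟩, Side.L) (⟨i + 1, hi'⟩, Side.L) := by
  have hj : ℓ + 1 - i ∈ Set.Icc 1 ℓ := by grind
  have := hi.2
  exact (reachable_L_R hi).trans <| (reachable_R_R hi hj (by omega)).trans <|
    (reachable_L_R hj).symm.trans (reachable_L_L hj hi' (by omega))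

theorem reachable_first_L (hℓ : 1 ≤ ℓ) (hi : i ∈ Set.Icc 1 ℓ) :
    (stitchGraph ℓ).Reachable (⟨1, le_rfl, hℓ⟩, Side.L) (⟨i, hi⟩, Side.L) := by
  obtain ⟨h1, hl⟩ := id hi
  induction i, h1 using Nat.le_induction with
  | base => rfl
  | succ k hk ih =>
    have hk' : k ∈ Set.Icc 1 ℓ := ⟨hk, by omega⟩
    exact (ih hk' hk'.2).trans (reachable_L_L_succ hk' hi)

theorem connected (hℓ : 1 ≤ ℓ) : (stitchGraph ℓ).Connected := by
  rw [SimpleGraph.connected_iff_exists_forall_reachable]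
  refine ⟨(⟨1, le_rfl, hℓ⟩, Side.L), ?_⟩
  rintro ⟨⟨i, hi⟩, _ | _⟩
  · exact reachable_first_L hℓ hi
  · exact (reachable_first_L hℓ hi).trans (reachable_L_R hi)

theorem ncard_neighborSet_eq_one_or_two (v : (Set.Icc 1 ℓ : Set ℕ) × Side) :
    ((stitchGraph ℓ).neighborSet v).ncard = 1 ∨ ((stitchGraph ℓ).neighborSet v).ncard = 2 := by
  obtain ⟨⟨i, hi⟩, _ | _⟩ := v
  · rw [ncard_neighborSet_L]
    split_ifs <;> simp
  · rw [ncard_neighborSet_R]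
    split_ifs <;> simp

theorem ncard_neighborSet_eq_one_iff (v : (Set.Icc 1 ℓ : Set ℕ) × Side) :
    ((stitchGraph ℓ).neighborSet v).ncard = 1 ↔
      (((v.1 : ℕ) = 1 ∧ v.2 = Side.L) ∨
       (Even ℓ ∧ (v.1 : ℕ) = ℓ / 2 + 1 ∧ v.2 = Side.L) ∨
       (¬ Even ℓ ∧ (v.1 : ℕ) = (ℓ + 1) / 2 ∧ v.2 = Side.R)) := by
  obtain ⟨⟨i, hi⟩, _ | _⟩ := v
  · simp [ncard_neighborSet_L, Nat.even_iff]
    omega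
  · simp [ncard_neighborSet_R, Nat.even_iff]
    omega

theorem ncard_setOf_ncard_neighborSet_eq_one (hℓ : 1 ≤ ℓ) :
    {v | ((stitchGraph ℓ).neighborSet v).ncard = 1}.ncard = 2 := by
  simp only [ncard_neighborSet_eq_one_iff]
  rw [Set.ncard_eq_two]
  by_cases h : Even ℓ
  · have h2 := Nat.even_iff.1 h
    refine ⟨(⟨1, le_rfl, hℓ⟩, Side.L), (⟨ℓ / 2 + 1, by grind⟩, Side.L),
      by simp [Subtype.ext_iff]; omega, ?_⟩
    ext ⟨⟨j, hj⟩, _ | _⟩ <;> simp [h, Subtype.ext_iff]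
  · refine ⟨(⟨1, le_rfl, hℓ⟩, Side.L), (⟨(ℓ + 1) / 2, by grind⟩, Side.R), by simp, ?_⟩
    ext ⟨⟨j, hj⟩, _ | _⟩ <;> simp [h, Subtype.ext_iff]

end stitchGraph

theorem stitchGraph_isPath (ℓ : ℕ) (hℓ : 1 ≤ ℓ) :
    (stitchGraph ℓ).Connected ∧
    (∀ v, ((stitchGraph ℓ).neighborSet v).ncard = 1 ∨
          ((stitchGraph ℓ).neighborSet v).ncard = 2) ∧
    {v | ((stitchGraph ℓ).neighborSet v).ncard = 1}.ncard = 2 ∧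
    (∀ v, ((stitchGraph ℓ).neighborSet v).ncard = 1 ↔
      (((v.1 : ℕ) = 1 ∧ v.2 = Side.L) ∨
       (Even ℓ ∧ (v.1 : ℕ) = ℓ / 2 + 1 ∧ v.2 = Side.L) ∨
       (¬ Even ℓ ∧ (v.1 : ℕ) = (ℓ + 1) / 2 ∧ v.2 = Side.R))) := by
  exact ⟨stitchGraph.connected hℓ, stitchGraph.ncard_neighborSet_eq_one_or_two,
    stitchGraph.ncard_setOf_ncard_neighborSet_eq_one hℓ,
    stitchGraph.ncard_neighborSet_eq_one_iff⟩
end
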